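/- The Gårding cone Γ_k = {λ ∈ ℝⁿ : σ_i(λ) ≥ 0 for all 1 ≤ i ≤ k} is a convex cone in ℝⁿ. -/

import Mathlib

open scoped BigOperators Classical
open MeasureTheory

noncomputable section

abbrev E (n : ℕ) := EuclideanSpace ℝ (Fin n)

/-- k-th elementary symmetric polynomial of a vector in ℝⁿ. -/
def esymm (n k : ℕ) (lam : Fin n → ℝ) : ℝ :=
  ∑ s ∈ Finset.univ.powersetCard k, ∏ i ∈ s, lam i

/-- Eigenvalue vector of a real symmetric matrix (junk value 0 otherwise). -/
def eigs {n : ℕ} (M : Matrix (Fin n) (Fin n) ℝ) : Fin n → ℝ :=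
  if h : M.IsHermitian then h.eigenvalues else 0

/-- σ_k of the eigenvalues of a symmetric matrix. -/
def Sk (n k : ℕ) (M : Matrix (Fin n) (Fin n) ℝ) : ℝ := esymm n k (eigs M)

/-- The (closed) Gårding cone Γ_k. -/
def GammaK (n k : ℕ) : Set (Fin n → ℝ) :=
  {lam | ∀ i, 1 ≤ i → i ≤ k → 0 ≤ esymm n i lam}

/-- i-th partial derivative. -/
def pd {n : ℕ} (u : E n → ℝ) (i : Fin n) (x : E n) : ℝ :=
  fderiv ℝ u x (EuclideanSpace.single i 1)

/-- Hessian matrix. -/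
def hess {n : ℕ} (u : E n → ℝ) (x : E n) : Matrix (Fin n) (Fin n) ℝ :=
  Matrix.of fun i j => pd (fun y => pd u j y) i x

/-- |∇u|². -/
def gradsq {n : ℕ} (u : E n → ℝ) (x : E n) : ℝ := ∑ i, (pd u i x) ^ 2

/-- The conformal Schouten-type matrix A_{ij}(u) = u u_{ij} - (1/2)|∇u|² δ_{ij}. -/
def Amat {n : ℕ} (u : E n → ℝ) (x : E n) : Matrix (Fin n) (Fin n) ℝ :=
  Matrix.of fun i j => u x * hess u x i j - (1 / 2) * gradsq u x * (if i = j then 1 else 0)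

open Polynomial in
/-- generating polynomial -/
def gpoly {ι : Type} (s : Finset ι) (a : ι → ℝ) : ℝ[X] :=
  ∏ i ∈ s, (1 + C (a i) * X)

/-- elementary symmetric function over a finset -/
def ee {ι : Type} (s : Finset ι) (k : ℕ) (a : ι → ℝ) : ℝ :=
  ∑ t ∈ s.powersetCard k, ∏ i ∈ t, a i

open Polynomial in
theorem gpoly_coeff {ι : Type} (s : Finset ι) (a : ι → ℝ) (k : ℕ) :
    (gpoly s a).coeff k = ee s k a := by
  unfold gpoly ee
  rw [Finset.prod_one_add, Polynomial.finsetSum_coeff, Finset.powersetCard_eq_filter,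
    Finset.sum_filter]
  refine Finset.sum_congr rfl fun t _ => ?_
  rw [Finset.prod_mul_distrib, Finset.prod_const, ← map_prod, Polynomial.coeff_C_mul,
    Polynomial.coeff_X_pow]
  by_cases h : t.card = k
  · simp [h]
  · simp [h, Ne.symm h]

theorem ee_zero {ι : Type} (s : Finset ι) (a : ι → ℝ) : ee s 0 a = 1 := by
  simp [ee]

open Polynomial in
theorem ee_erase {ι : Type} (s : Finset ι) (a : ι → ℝ) (k : ℕ) (i : ι) (hi : i ∈ s) :
    ee s (k+1) a = ee (s.erase i) (k+1) a + a i * ee (s.erase i) k a := by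
  simp only [← gpoly_coeff]
  have : gpoly s a = (1 + C (a i) * X) * gpoly (s.erase i) a := by
    unfold gpoly
    exact (Finset.mul_prod_erase s (fun i => 1 + C (a i) * X) hi).symm
  rw [this, add_mul, one_mul, mul_assoc, coeff_add, coeff_C_mul, coeff_X_mul]

open Polynomial in
theorem ee_sum {ι : Type} (s : Finset ι) (a : ι → ℝ) (k : ℕ) :
    ∑ i ∈ s, a i * ee (s.erase i) k a = (k+1) * ee s (k+1) a := by
  have h : derivative (gpoly s a) = ∑ i ∈ s, C (a i) * gpoly (s.erase i) a := by
    unfold gpoly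
    rw [derivative_prod_finset]
    refine Finset.sum_congr rfl fun i _ => ?_
    simp only [derivative_add, derivative_one, derivative_C_mul, derivative_X, zero_add, mul_one]; rw [mul_comm]
  have h2 := congrArg (fun p => p.coeff k) h
  simp only [coeff_derivative, finsetSum_coeff, coeff_C_mul, gpoly_coeff] at h2
  rw [← h2]; ring

open Polynomial in
theorem splits_deriv (p : ℝ[X]) (hp : p.Splits) : (derivative p).Splits := by
  by_cases h0 : p.natDegree = 0
  · rw [Polynomial.natDegree_eq_zero] at h0
    obtain ⟨x, rfl⟩ := h0
    simp
  · have h1 := card_roots_le_derivative p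
    have h2 := natDegree_derivative p
    have h3 := card_roots' (derivative p)
    rw [splits_iff_card_roots] at hp ⊢
    omega

open Polynomial in
theorem laguerre (p : ℝ[X]) (hp : p.Splits) :
    2 * p.coeff 0 * p.coeff 2 ≤ p.coeff 1 ^ 2 := by
  rw [hp.eq_prod_roots]
  generalize p.roots = m
  generalize p.leadingCoeff = c
  have key : 2 * ((m.map (fun a => X - C a)).prod).coeff 0 * ((m.map (fun a => X - C a)).prod).coeff 2
      ≤ ((m.map (fun a => X - C a)).prod).coeff 1 ^ 2 := by
    induction m using Multiset.induction_on with
    | empty => simp [coeff_one]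
    | cons r m ih =>
      rw [Multiset.map_cons, Multiset.prod_cons]
      generalize (Multiset.map (fun a => X - C a) m).prod = g at *
      rw [sub_mul]
      simp only [coeff_sub, coeff_C_mul, coeff_X_mul, coeff_X_mul_zero]
      nlinarith [mul_le_mul_of_nonneg_left ih (sq_nonneg r), sq_nonneg (g.coeff 0)]
  simp only [coeff_C_mul]
  nlinarith [mul_le_mul_of_nonneg_left key (sq_nonneg c)]

open Polynomial in
theorem newton {ι : Type} (s : Finset ι) (a : ι → ℝ) (k : ℕ) :
    (k+2) * (ee s k a * ee s (k+2) a) ≤ (k+1) * ee s (k+1) a ^ 2 := by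
  have hs : (gpoly s a).Splits := by
    unfold gpoly
    refine Splits.prod fun i _ => ?_
    refine Splits.of_natDegree_le_one ?_
    compute_degree
  have hk : (derivative^[k] (gpoly s a)).Splits := by
    induction k with
    | zero => simpa
    | succ k ih => rw [Function.iterate_succ_apply']; exact splits_deriv _ ih
  have h := laguerre _ hk
  simp only [coeff_iterate_derivative, gpoly_coeff, nsmul_eq_mul] at h
  have e0 : (((0+k).descFactorial k : ℕ) : ℝ) = (k.factorial : ℝ) := by
    simp [Nat.descFactorial_self]
  have e1 : (((1+k).descFactorial k : ℕ) : ℝ) = (k+1) * (k.factorial : ℝ) := by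
    have := Nat.factorial_mul_descFactorial (show k ≤ 1 + k by omega)
    rw [show 1 + k - k = 1 by omega, add_comm 1 k, Nat.factorial_succ k] at this
    rw [add_comm 1 k]
    simp at this
    rw [this]; push_cast; ring
  have e2 : 2 * (((2+k).descFactorial k : ℕ) : ℝ) = (k+2) * ((k+1) * (k.factorial : ℝ)) := by
    have := Nat.factorial_mul_descFactorial (show k ≤ 2 + k by omega)
    rw [show 2 + k - k = 2 by omega, add_comm 2 k, Nat.factorial_succ (k+1),
      Nat.factorial_succ k] at this
    rw [add_comm 2 k]
    have h2 : (((2).factorial * (k+2).descFactorial k : ℕ) : ℝ)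
      = (((k + 1 + 1) * ((k + 1) * k.factorial) : ℕ) : ℝ) := by rw [this]
    push_cast [Nat.factorial] at h2
    linarith
  rw [zero_add, add_comm 1 k, add_comm 2 k] at h
  rw [zero_add] at e0
  rw [add_comm 1 k] at e1
  rw [add_comm 2 k] at e2
  rw [e0, e1] at h
  have hf : (0:ℝ) < (k+1) * (k.factorial : ℝ) ^ 2 := by positivity
  refine le_of_mul_le_mul_left ?_ hf
  calc _ = (k.factorial : ℝ) * ee s k a * (((k+2) * ((k+1) * (k.factorial : ℝ))) * ee s (k+2) a) := by ring
    _ = _ := by rw [← e2]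
    _ ≤ _ := by refine le_trans (le_of_eq ?_) h; ring
    _ = _ := by ring

def PosK {ι : Type} (s : Finset ι) (k : ℕ) (a : ι → ℝ) : Prop := ∀ j ≤ k, 0 < ee s j a

theorem PosK.del {ι : Type} {s : Finset ι} {a : ι → ℝ} {i : ι} (hi : i ∈ s) :
    ∀ k, PosK s (k+1) a → PosK (s.erase i) k a := by
  intro k
  induction k with
  | zero =>
    intro _ j hj
    obtain rfl : j = 0 := by omega
    rw [ee_zero]; exact one_pos
  | succ k ih =>
    intro h
    have hk := ih (fun j hj => h j (by omega))
    have : 0 < ee (s.erase i) (k+1) a := by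
      by_contra! hc
      have h1 := h (k+1) (by omega)
      have h2 := h (k+2) (by omega)
      rw [ee_erase s a _ i hi] at h1 h2
      have h0 := hk k le_rfl
      have hN := newton (s.erase i) a k
      generalize ee (s.erase i) (k+1) a = y at *
      generalize ee (s.erase i) (k+1+1) a = z at *
      generalize ee (s.erase i) k a = x at *
      generalize a i = l at *
      have hl : 0 < l := by
        by_contra! hl
        nlinarith
      have hz : 0 < z := by nlinarith
      have h3 : y ^ 2 ≤ x * z := by nlinarith
      have h4 : 0 < x * z := by positivity
      have h5 : (0:ℝ) ≤ k := k.cast_nonneg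
      nlinarith
    intro j hj
    rcases Nat.lt_or_ge j (k+1) with h' | h'
    · exact hk j (by omega)
    · obtain rfl : j = k+1 := by omega
      exact this

theorem sq_div_aux (x z y w v : ℝ) (hy : 0 < y) (hw : 0 < w) (hv : y + w ≤ v) :
    (x + z)^2 / v ≤ x^2/y + z^2/w := by
  calc (x+z)^2/v ≤ (x+z)^2/(y+w) := by gcongr
    _ ≤ _ := by
      rw [div_add_div _ _ hy.ne' hw.ne', div_le_div_iff₀ (by positivity) (by positivity)]
      nlinarith [mul_nonneg (mul_pos hy hw).le (sq_nonneg 1), sq_nonneg (x*w - z*y)]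

theorem q_formula {ι : Type} {s : Finset ι} {a : ι → ℝ} {k : ℕ} (h : PosK s (k+1) a) :
    (k+2) * (ee s (k+2) a / ee s (k+1) a) = ∑ i ∈ s, a i -
      ∑ i ∈ s, a i ^ 2 / (a i + ee (s.erase i) (k+1) a / ee (s.erase i) k a) := by
  have h1 := ee_sum s a (k+1)
  have hp := h (k+1) le_rfl
  have : ((k:ℝ)+2) * ee s (k+2) a = ∑ i ∈ s, a i * ee (s.erase i) (k+1) a := by
    rw [h1]; push_cast; ring
  rw [← mul_div_assoc, this, Finset.sum_div, ← Finset.sum_sub_distrib]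
  refine Finset.sum_congr rfl fun i hi => ?_
  have hd := (PosK.del hi k h) k le_rfl
  have he := ee_erase s a k i hi
  have h3 : a i + ee (s.erase i) (k+1) a / ee (s.erase i) k a
    = ee s (k+1) a / ee (s.erase i) k a := by
    rw [he]; field_simp; ring
  rw [h3]
  have h4 : ee (s.erase i) (k+1) a = ee s (k+1) a - a i * ee (s.erase i) k a := by
    rw [he]; ring
  rw [h4]
  field_simp

theorem super {ι : Type} (a b : ι → ℝ) : ∀ (k : ℕ) (s : Finset ι),
    PosK s k a → PosK s k b → PosK s k (a+b) ∧
      ee s (k+1) a / ee s k a + ee s (k+1) b / ee s k b ≤ ee s (k+1) (a+b) / ee s k (a+b) := by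
  intro k
  induction k with
  | zero =>
    intro s ha hb
    refine ⟨fun j hj => ?_, ?_⟩
    · obtain rfl : j = 0 := by omega
      rw [ee_zero]; exact one_pos
    · have h1 : ∀ c : ι → ℝ, ee s (0+1) c = ∑ i ∈ s, c i := fun c => by
        have := ee_sum s c 0
        simp only [ee_zero] at this
        simpa using this.symm
      simp only [h1, ee_zero, Pi.add_apply, Finset.sum_add_distrib, div_one, le_refl]
  | succ k ih =>
    intro s ha hb
    have ⟨h1, h2⟩ := ih s (fun j hj => ha j (by omega)) (fun j hj => hb j (by omega))
    have hab : PosK s (k+1) (a+b) := by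
      intro j hj
      rcases Nat.lt_or_ge j (k+1) with h' | h'
      · exact h1 j (by omega)
      · obtain rfl : j = k+1 := by omega
        have p1 := div_pos (ha (k+1) le_rfl) (ha k (by omega))
        have p2 := div_pos (hb (k+1) le_rfl) (hb k (by omega))
        have p3 := h1 k le_rfl
        exact (div_pos_iff_of_pos_right p3).1 (by linarith)
    refine ⟨hab, ?_⟩
    have hk : (0:ℝ) < k + 2 := by positivity
    refine le_of_mul_le_mul_left ?_ hk
    rw [mul_add, q_formula ha, q_formula hb, q_formula hab]
    have : ∑ i ∈ s, (a+b) i ^ 2 / ((a+b) i + ee (s.erase i) (k+1) (a+b) / ee (s.erase i) k (a+b))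
      ≤ ∑ i ∈ s, a i ^ 2 / (a i + ee (s.erase i) (k+1) a / ee (s.erase i) k a)
       + ∑ i ∈ s, b i ^ 2 / (b i + ee (s.erase i) (k+1) b / ee (s.erase i) k b) := by
      rw [← Finset.sum_add_distrib]
      refine Finset.sum_le_sum fun i hi => ?_
      have pos : ∀ c : ι → ℝ, PosK s (k+1) c →
          0 < c i + ee (s.erase i) (k+1) c / ee (s.erase i) k c := fun c hc => by
        have hd := (PosK.del hi k hc) k le_rfl
        have he := ee_erase s c k i hi
        have hp := hc (k+1) le_rfl
        have h3 : c i + ee (s.erase i) (k+1) c / ee (s.erase i) k c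
          = ee s (k+1) c / ee (s.erase i) k c := by
          rw [he]; field_simp; ring
        rw [h3]; positivity
      refine sq_div_aux _ _ _ _ _ (pos a ha) (pos b hb) ?_
      have := (ih (s.erase i) (PosK.del hi k ha) (PosK.del hi k hb)).2
      simp only [Pi.add_apply] at *
      linarith
    have e : ∑ i ∈ s, (a+b) i = ∑ i ∈ s, a i + ∑ i ∈ s, b i := by
      simp [Finset.sum_add_distrib]
    linarith

open Polynomial in
theorem shift_pos {ι : Type} (s : Finset ι) (a : ι → ℝ) (k : ℕ) (hk : k ≤ s.card)
    (h : ∀ j ≤ k, 0 ≤ ee s j a) (ε : ℝ) (hε : 0 < ε) : 0 < ee s k (fun i => a i + ε) := by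
  have c1 := Finset.prod_X_add_C_coeff s (fun i => a i + ε) (k := s.card - k) (by omega)
  rw [show s.card - (s.card - k) = k by omega] at c1
  have c2 : ∏ i ∈ s, (X + C (a i + ε)) = taylor ε (∏ i ∈ s, (X + C (a i))) := by
    rw [taylor_apply, prod_comp]
    refine Finset.prod_congr rfl fun i _ => ?_
    simp; ring
  set f := ∏ i ∈ s, (X + C (a i)) with hf
  have hm : f.Monic := monic_prod_of_monic _ _ fun i _ => monic_X_add_C _
  have hd : f.natDegree = s.card := by
    rw [hf, natDegree_prod_of_monic _ _ fun i _ => monic_X_add_C _]; simp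
  unfold ee
  rw [← c1, c2, taylor_coeff, hasseDeriv_apply, Polynomial.sum_def, eval_finsetSum]
  simp only [eval_monomial]
  have hnn : ∀ m ∈ f.support, 0 ≤ ((m.choose (s.card - k) : ℕ) : ℝ) * f.coeff m * ε ^ (m - (s.card - k)) := by
    intro m hm
    have hle : m ≤ s.card := hd ▸ le_natDegree_of_mem_supp m hm
    by_cases hlt : m < s.card - k
    · simp [Nat.choose_eq_zero_of_lt hlt]
    · have := Finset.prod_X_add_C_coeff s a hle
      have h2 : 0 ≤ f.coeff m := by
        rw [hf, this]; exact h _ (by omega)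
      positivity
  refine Finset.sum_pos' hnn ⟨s.card, ?_, ?_⟩
  · rw [mem_support_iff, ← hd]; simp [hm]
  · have : f.coeff s.card = 1 := by rw [← hd]; exact hm
    rw [this]
    have : 0 < s.card.choose (s.card - k) := Nat.choose_pos (by omega)
    positivity

theorem gamma_add (n k : ℕ) (a b : Fin n → ℝ) (ha : a ∈ GammaK n k) (hb : b ∈ GammaK n k) :
    a + b ∈ GammaK n k := by
  intro j hj1 hjk
  by_cases hjn : j ≤ n
  swap
  · unfold esymm
    rw [Finset.powersetCard_eq_empty.2 (by simpa using hjn)]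
    simp
  have key : ∀ c : Fin n → ℝ, c ∈ GammaK n k → ∀ ε : ℝ, 0 < ε →
      PosK Finset.univ j (fun i => c i + ε) := by
    intro c hc ε hε l hl
    refine shift_pos _ _ _ (by simp; omega) (fun m hm => ?_) ε hε
    rcases Nat.eq_zero_or_pos m with rfl | h
    · rw [ee_zero]; exact zero_le_one
    · exact hc m h (by omega)
  have hpos : ∀ ε : ℝ, 0 < ε →
      0 ≤ esymm n j ((fun i => a i + ε) + (fun i => b i + ε)) := fun ε hε =>
    ((super _ _ j Finset.univ (key a ha ε hε) (key b hb ε hε)).1 j le_rfl).le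
  have hcont : Continuous fun ε : ℝ => esymm n j ((fun i => a i + ε) + (fun i => b i + ε)) := by
    unfold esymm
    simp only [Pi.add_apply]
    fun_prop
  have hlim := (hcont.tendsto 0).mono_left (nhdsWithin_le_nhds (s := Set.Ioi 0))
  have := ge_of_tendsto hlim (by
    filter_upwards [self_mem_nhdsWithin] with ε hε using hpos ε hε)
  simpa only [add_zero] using this

theorem gamma_smul (n k : ℕ) (c : ℝ) (hc : 0 ≤ c) (a : Fin n → ℝ) (ha : a ∈ GammaK n k) :
    c • a ∈ GammaK n k := by
  intro j hj1 hjk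
  have : esymm n j (c • a) = c ^ j * esymm n j a := by
    unfold esymm
    rw [Finset.mul_sum]
    refine Finset.sum_congr rfl fun t ht => ?_
    simp [Finset.prod_mul_distrib, (Finset.mem_powersetCard.1 ht).2]
  rw [this]
  exact mul_nonneg (pow_nonneg hc j) (ha j hj1 hjk)

theorem stmt3 (n k : ℕ) :
    Convex ℝ (GammaK n k) ∧
      (∀ a ∈ GammaK n k, ∀ b ∈ GammaK n k, a + b ∈ GammaK n k) ∧
      (∀ c : ℝ, 0 ≤ c → ∀ a ∈ GammaK n k, c • a ∈ GammaK n k) := by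
  refine ⟨?_, fun a ha b hb => gamma_add n k a b ha hb, fun c hc a ha => gamma_smul n k c hc a ha⟩
  intro a ha b hb u v hu hv _
  exact gamma_add n k _ _ (gamma_smul n k u hu a ha) (gamma_smul n k v hv b hb)
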